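/- Let B be a finite brace (i.e. a skew brace whose additive group (B,+) is abelian) such that b∗b = 0 for all b ∈ B. Then B is centrally nilpotent. -/

import Mathlib

/-- A (left) skew brace: a set with two group structures `(B,+)` and `(B,·)`
satisfying `a · (b + c) = a · b - a + a · c`. -/
class SkewBrace (B : Type*) extends AddGroup B, Group B where
  skew : ∀ a b c : B, a * (b + c) = a * b - a + a * c

/-- The star product of a skew brace: `a ∗ b = -a + a·b - b`. -/
def sstar {B : Type*} [SkewBrace B] (a b : B) : B := -a + a * b - b

/-- The upper central series of a skew brace, defined elementwise:
`zeta B 0 = {0}` and `x ∈ zeta B (n+1)` iff the image of `x` in the quotient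
`B / zeta B n` lies in `ζ(B/zeta B n) = Soc(B/zeta B n) ∩ Z(B/zeta B n, ·)`,
i.e. iff for all `b`, `x·b ≡ x + b` (so `x` is in the kernel of the `λ`-map of
the quotient), `x + b ≡ b + x` and `x·b ≡ b·x` modulo `zeta B n`. -/
def zeta (B : Type*) [SkewBrace B] : ℕ → Set B
  | 0 => {0}
  | n + 1 =>
    {x | ∀ b : B,
      -(x * b) + (x + b) ∈ zeta B n ∧
      -(x + b) + (b + x) ∈ zeta B n ∧
      (x * b)⁻¹ * (b * x) ∈ zeta B n}

/-- A skew brace is centrally nilpotent if its upper central series reaches `B`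
after finitely many steps. -/
def CentrallyNilpotent (B : Type*) [SkewBrace B] : Prop :=
  ∃ n : ℕ, zeta B n = Set.univ

/-- The additive group of a brace as a commutative group. -/
abbrev SkewBrace.addCommGroup {B : Type*} [SkewBrace B]
    (habel : ∀ a b : B, a + b = b + a) : AddCommGroup B where
  add_comm := habel

namespace SkewBrace

variable {B : Type*} [SkewBrace B]

theorem mul_zero_eq_self (a : B) : a * 0 = a := by
  have h := SkewBrace.skew a 0 0
  rw [add_zero, sub_eq_add_neg, add_assoc, left_eq_add] at h
  exact (neg_add_eq_zero.mp h).symm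

theorem zero_eq_one : (0 : B) = 1 :=
  mul_eq_left.mp (mul_zero_eq_self (1 : B))

theorem zero_sstar (a : B) : sstar 0 a = 0 := by
  have h : (0 : B) * a = a := by rw [zero_eq_one, one_mul]
  simp [sstar, h]

theorem sstar_zero (a : B) : sstar a 0 = 0 := by
  simp [sstar, mul_zero_eq_self]

theorem mul_eq_add_add_sstar (habel : ∀ a b : B, a + b = b + a)
    (a b : B) : a * b = a + b + sstar a b := by
  let := addCommGroup habel
  unfold sstar
  abel

theorem sstar_add (habel : ∀ a b : B, a + b = b + a)
    (a b c : B) : sstar a (b + c) = sstar a b + sstar a c := by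
  let := addCommGroup habel
  unfold sstar
  rw [SkewBrace.skew]
  abel

theorem sstar_neg (habel : ∀ a b : B, a + b = b + a)
    (a b : B) : sstar a (-b) = -sstar a b := by
  rw [eq_neg_iff_add_eq_zero, ← sstar_add habel, neg_add_cancel, sstar_zero]

theorem mul_sstar (habel : ∀ a b : B, a + b = b + a)
    (a b c : B) :
    sstar (a * b) c = sstar a c + sstar b c + sstar a (sstar b c) := by
  let := addCommGroup habel
  have h := mul_assoc a b c
  rw [mul_eq_add_add_sstar habel (a * b) c, mul_eq_add_add_sstar habel a (b * c),
    mul_eq_add_add_sstar habel b c, sstar_add habel, sstar_add habel] at h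
  have h' : sstar (a * b) c =
      a + (b + c + sstar b c) + (sstar a b + sstar a c + sstar a (sstar b c)) - (a * b + c) := by
    rw [← h]
    abel
  rw [h', mul_eq_add_add_sstar habel a b]
  abel

theorem inv_eq_neg (habel : ∀ a b : B, a + b = b + a)
    (hstar : ∀ b : B, sstar b b = 0) (a : B) : a⁻¹ = -a := by
  refine inv_eq_of_mul_eq_one_right ?_
  rw [mul_eq_add_add_sstar habel, sstar_neg habel, hstar]
  simp [zero_eq_one]

theorem neg_sstar_eq_sstar_swap (habel : ∀ a b : B, a + b = b + a)
    (hstar : ∀ b : B, sstar b b = 0) (a c : B) : sstar (-c) a = sstar a c := by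
  let := addCommGroup habel
  have hu : a * c = a + c + sstar a c := mul_eq_add_add_sstar habel a c
  have hc : -a * (a * c) = c := by rw [← inv_eq_neg habel hstar, inv_mul_cancel_left]
  have h₁ : sstar c (a * c) = sstar (-a) (a * c) := by
    have h := mul_sstar habel (-a) (a * c) (a * c)
    rwa [hc, hstar, sstar_zero, add_zero, add_zero] at h
  have h₂ : sstar c (a * c) = -sstar a c := by
    rw [mul_eq_add_add_sstar habel (-a) (a * c), ← h₁] at hc
    rw [eq_sub_of_add_eq' hc, hu]
    abel
  have h₃ : sstar (-c) (a + c) = sstar a c := by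
    have h := mul_sstar habel (-c) c (a * c)
    rw [← inv_eq_neg habel hstar, inv_mul_cancel, ← zero_eq_one, zero_sstar,
      inv_eq_neg habel hstar, add_right_comm, ← sstar_add habel, h₂, hu,
      add_neg_cancel_right] at h
    rw [← sub_eq_zero, sub_eq_add_neg, ← h]
  have h₄ : sstar (-c) c = 0 := by
    rw [← neg_eq_zero, ← sstar_neg habel, hstar]
  rw [← h₃, sstar_add habel, h₄, add_zero]

theorem neg_sstar (habel : ∀ a b : B, a + b = b + a)
    (hstar : ∀ b : B, sstar b b = 0) (a c : B) : sstar (-a) c = -sstar a c := by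
  rw [← neg_sstar_eq_sstar_swap habel hstar a c, ← neg_sstar_eq_sstar_swap habel hstar (-c) a,
    sstar_neg habel, neg_neg]

theorem sstar_anticomm (habel : ∀ a b : B, a + b = b + a)
    (hstar : ∀ b : B, sstar b b = 0) (a c : B) : sstar a c = -sstar c a := by
  rw [← neg_sstar_eq_sstar_swap habel hstar, neg_sstar habel hstar]

theorem add_sstar (habel : ∀ a b : B, a + b = b + a)
    (hstar : ∀ b : B, sstar b b = 0) (a b c : B) : sstar (a + b) c = sstar a c + sstar b c := by
  let := addCommGroup habel
  rw [sstar_anticomm habel hstar, sstar_add habel, sstar_anticomm habel hstar a c,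
    sstar_anticomm habel hstar b c]
  abel

theorem sstar_assoc (habel : ∀ a b : B, a + b = b + a)
    (hstar : ∀ b : B, sstar b b = 0) (a b c : B) : sstar (sstar a b) c = sstar a (sstar b c) := by
  have h := mul_sstar habel a b c
  rw [mul_eq_add_add_sstar habel, add_sstar habel hstar, add_sstar habel hstar] at h
  exact add_left_cancel h

theorem sstar_right_comm (habel : ∀ a b : B, a + b = b + a)
    (hstar : ∀ b : B, sstar b b = 0) (a b c : B) : sstar (sstar a b) c = -sstar (sstar a c) b := by
  rw [sstar_assoc habel hstar, sstar_anticomm habel hstar b c, sstar_neg habel,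
    sstar_assoc habel hstar]

theorem inv_mul_swap (habel : ∀ a b : B, a + b = b + a)
    (hstar : ∀ b : B, sstar b b = 0) (a b : B) : (a * b)⁻¹ * (b * a) = sstar a (-(b + b)) := by
  let := addCommGroup habel
  have hab : sstar a (sstar a b) = 0 := by
    rw [← sstar_assoc habel hstar, hstar, zero_sstar]
  have hba : sstar b (sstar a b) = 0 := by
    rw [sstar_anticomm habel hstar, sstar_assoc habel hstar, hstar, sstar_zero, neg_zero]
  have hs : sstar (a * b) (sstar a b) = 0 := by
    rw [mul_sstar habel, hab, hba, sstar_zero, add_zero, add_zero]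
  have hswap : b * a = a * b + -(sstar a b + sstar a b) := by
    rw [mul_eq_add_add_sstar habel b a, mul_eq_add_add_sstar habel a b,
      sstar_anticomm habel hstar b a]
    abel
  rw [inv_eq_neg habel hstar, hswap, mul_eq_add_add_sstar habel, neg_sstar habel hstar,
    sstar_add habel, hstar, sstar_neg habel, sstar_add habel, hs, sstar_neg habel,
    sstar_add habel]
  abel

/-- `RightAnnihilated n x` says that every left-normed star product
`(⋯((x ∗ b₁) ∗ b₂) ⋯) ∗ bₙ` vanishes. -/
def RightAnnihilated : ℕ → B → Prop
  | 0, x => x = 0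
  | n + 1, x => ∀ b : B, RightAnnihilated n (sstar x b)

theorem rightAnnihilated_zero (n : ℕ) : RightAnnihilated n (0 : B) := by
  induction n with
  | zero => rfl
  | succ n ih =>
    intro b
    rwa [zero_sstar]

theorem RightAnnihilated.mem_zeta (habel : ∀ a b : B, a + b = b + a)
    (hstar : ∀ b : B, sstar b b = 0) {n : ℕ} {x : B} (h : RightAnnihilated n x) :
    x ∈ zeta B n := by
  let := addCommGroup habel
  induction n generalizing x with
  | zero => exact h
  | succ n ih =>
    intro b
    refine ⟨?_, ?_, ?_⟩
    · have hb : -(x * b) + (x + b) = sstar x (-b) := by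
        rw [mul_eq_add_add_sstar habel, sstar_neg habel]
        abel
      exact hb ▸ ih (h _)
    · rw [habel b x, neg_add_cancel]
      exact ih (rightAnnihilated_zero n)
    · rw [inv_mul_swap habel hstar]
      exact ih (h _)

theorem rightAnnihilated_of_card_lt [Fintype B] (habel : ∀ a b : B, a + b = b + a)
    (hstar : ∀ b : B, sstar b b = 0) {n : ℕ} {x : B} (S : Finset B)
    (hcard : Fintype.card B < S.card + n) (hS : ∀ s ∈ S, sstar x s = 0) :
    RightAnnihilated n x := by
  classical
  induction n generalizing x S with
  | zero => exact absurd S.card_le_univ (by simpa using hcard)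
  | succ n ih =>
    intro b
    by_cases hb : b ∈ S
    · rw [hS b hb]
      exact rightAnnihilated_zero n
    · refine ih (insert b S) (by rw [Finset.card_insert_of_notMem hb]; omega) fun s hs => ?_
      rcases Finset.mem_insert.mp hs with rfl | hs
      · rw [sstar_assoc habel hstar, hstar, sstar_zero]
      · rw [sstar_right_comm habel hstar, hS s hs, zero_sstar, neg_zero]

end SkewBrace

/-- A finite brace (i.e. a skew brace with abelian additive group) in which
`b ∗ b = 0` for all `b` is centrally nilpotent. -/
theorem statement2 (B : Type*) [SkewBrace B] [Fintype B]
    (habel : ∀ a b : B, a + b = b + a)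
    (hstar : ∀ b : B, sstar b b = 0) :
    CentrallyNilpotent B :=
  ⟨Fintype.card B + 1, Set.eq_univ_of_forall fun _ =>
    (SkewBrace.rightAnnihilated_of_card_lt habel hstar ∅ (by simp) (by simp)).mem_zeta
      habel hstar⟩
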